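/- Let N = 19 and let τ = (−19 + √−19)/38 ∈ ℍ (real part −1/2 and imaginary part √19/38), the Heegner point of discriminant −19, which represents the unique non-cuspidal rational point of X₀(19). Then E₂^{(19)}(τ) ≠ 0, a₄(τ) = −19/2, and a₆(τ) = −361/32; that is, the elliptic curve with cyclic 19-isogeny attached to this point has Weierstrass model y² = x³ − (19/2)x − 361/32. -/

import Mathlib

open Complex UpperHalfPlane Matrix MatrixGroups Filter

/-- `q = e^{2πiτ}`. -/
noncomputable def qExp (τ : ℂ) : ℂ := Complex.exp (2 * Real.pi * Complex.I * τ)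

/-- `σ_k(n) = Σ_{d ∣ n} d^k`. -/
def sigma' (k n : ℕ) : ℕ := ∑ d ∈ n.divisors, d ^ k

/-- Normalized Eisenstein series `E₄(τ) = 1 + 240 Σ_{n≥1} σ₃(n) qⁿ`. -/
noncomputable def E4 (τ : ℂ) : ℂ := 1 + 240 * ∑' n : ℕ+, (sigma' 3 n : ℂ) * qExp τ ^ (n : ℕ)

/-- Normalized Eisenstein series `E₆(τ) = 1 − 504 Σ_{n≥1} σ₅(n) qⁿ`. -/
noncomputable def E6 (τ : ℂ) : ℂ := 1 - 504 * ∑' n : ℕ+, (sigma' 5 n : ℂ) * qExp τ ^ (n : ℕ)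

/-- Normalized weight-2 Eisenstein series `E₂(τ) = 1 − 24 Σ_{n≥1} σ₁(n) qⁿ`. -/
noncomputable def E2 (τ : ℂ) : ℂ := 1 - 24 * ∑' n : ℕ+, (sigma' 1 n : ℂ) * qExp τ ^ (n : ℕ)

/-- `E₂^{(N)}(τ) = (N−1)/24 + Σ_{n≥1} σ₁(n)(qⁿ − N q^{Nn})`. -/
noncomputable def E2N (N : ℕ) (τ : ℂ) : ℂ :=
  ((N : ℂ) - 1) / 24 +
    ∑' n : ℕ+, (sigma' 1 n : ℂ) * (qExp τ ^ (n : ℕ) - (N : ℂ) * qExp τ ^ (N * (n : ℕ)))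

/-- `a₄(τ) = −E₄(τ)/(48 E₂^{(N)}(τ)²)`. -/
noncomputable def a4 (N : ℕ) (τ : ℂ) : ℂ := -E4 τ / (48 * E2N N τ ^ 2)

/-- `a₆(τ) = E₆(τ)/(864 E₂^{(N)}(τ)³)`. -/
noncomputable def a6 (N : ℕ) (τ : ℂ) : ℂ := E6 τ / (864 * E2N N τ ^ 3)

/-- `a₄′(τ) = −E₄(Nτ)/(48 E₂^{(N)}(τ)²)`. -/
noncomputable def a4' (N : ℕ) (τ : ℂ) : ℂ := -E4 ((N : ℂ) * τ) / (48 * E2N N τ ^ 2)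

/-- `a₆′(τ) = E₆(Nτ)/(864 E₂^{(N)}(τ)³)`. -/
noncomputable def a6' (N : ℕ) (τ : ℂ) : ℂ := E6 ((N : ℂ) * τ) / (864 * E2N N τ ^ 3)


open scoped Topology

lemma deriv_P_not_eventually_zero (L : PeriodPair) (x : ℂ) (hx : x ∉ L.lattice) :
    ¬ (∀ᶠ z in 𝓝 x, L.derivWeierstrassP z = 0) := by
  intro h
  have hcount : (L.lattice : Set ℂ).Countable := by
    have : Countable L.lattice := L.latticeEquivProd.toEquiv.countable_iff.mpr inferInstance
    exact Set.to_countable _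
  have hconn : IsPreconnected ((L.lattice : Set ℂ)ᶜ) :=
    (hcount.isPathConnected_compl_of_one_lt_rank (by simp)).isConnected.isPreconnected
  have hz := L.analyticOnNhd_derivWeierstrassP.eqOn_zero_of_preconnected_of_eventuallyEq_zero
    hconn (z₀ := x) hx h
  have hz' : ∀ z, L.derivWeierstrassP z = 0 := by
    intro z
    by_cases hzl : z ∈ L.lattice
    · exact L.derivWeierstrassP_coe ⟨z, hzl⟩
    · exact hz hzl
  have h1 : ∀ z, L.derivWeierstrassPExcept 0 z = 2 / z ^ 3 := by
    intro z
    have := L.derivWeierstrassPExcept_def 0 z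
    simpa [hz'] using this
  have hc : Tendsto (L.derivWeierstrassPExcept 0) (𝓝[≠] 0) (𝓝 0) := by
    have := (L.analyticAt_derivWeierstrassPExcept 0).continuousAt.tendsto
    rw [L.derivWeierstrassPExcept_zero_zero] at this
    exact this.mono_left nhdsWithin_le_nhds
  have hid : Tendsto (fun z : ℂ => z ^ 3) (𝓝[≠] 0) (𝓝 0) := by
    have : Tendsto (fun z : ℂ => z ^ 3) (𝓝 0) (𝓝 (0 ^ 3)) := (continuous_pow 3).tendsto 0
    simpa using this.mono_left nhdsWithin_le_nhds
  have hm := hc.mul hid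
  have : Tendsto (fun _ : ℂ => (2 : ℂ)) (𝓝[≠] (0 : ℂ)) (𝓝 (0 * 0)) := by
    refine hm.congr' ?_
    filter_upwards [self_mem_nhdsWithin] with z hz
    rw [h1]
    have : z ≠ 0 := hz
    field_simp
  have h2 := tendsto_nhds_unique this tendsto_const_nhds
  norm_num at h2

lemma deriv_derivP (L : PeriodPair) (x : ℂ) (hx : x ∉ L.lattice) :
    deriv L.derivWeierstrassP x = 6 * L.weierstrassP x ^ 2 - L.g₂ / 2 := by
  have hopen : IsOpen ((L.lattice : Set ℂ)ᶜ) := L.isClosed_lattice.isOpen_compl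
  have haP := L.analyticOnNhd_weierstrassP x hx
  have haD := L.analyticOnNhd_derivWeierstrassP x hx
  have haDD := haD.deriv
  let H : ℂ → ℂ := fun z => deriv L.derivWeierstrassP z - (6 * L.weierstrassP z ^ 2 - L.g₂ / 2)
  have haH : AnalyticAt ℂ H x := by
    simp only [H]
    fun_prop
  have key : ∀ z ∉ L.lattice, L.derivWeierstrassP z * H z = 0 := by
    intro z hz
    have h1 : (fun y => L.derivWeierstrassP y ^ 2) =ᶠ[𝓝 z]
        fun y => 4 * L.weierstrassP y ^ 3 - L.g₂ * L.weierstrassP y - L.g₃ := by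
      filter_upwards [hopen.mem_nhds hz] with y hy
      exact L.derivWeierstrassP_sq y hy
    have h2 := h1.deriv_eq
    have dP : HasDerivAt L.weierstrassP (L.derivWeierstrassP z) z := by
      rw [← L.deriv_weierstrassP]
      exact (L.analyticOnNhd_weierstrassP z hz).differentiableAt.hasDerivAt
    have dD : HasDerivAt L.derivWeierstrassP (deriv L.derivWeierstrassP z) z :=
      (L.analyticOnNhd_derivWeierstrassP z hz).differentiableAt.hasDerivAt
    have e1 := (dD.pow 2).deriv
    have e2 := ((((dP.pow 3).const_mul 4).sub (dP.const_mul L.g₂)).sub_const L.g₃).deriv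
    have h3 : deriv (L.derivWeierstrassP ^ 2) z = deriv (fun y => 4 * L.weierstrassP y ^ 3 - L.g₂ * L.weierstrassP y - L.g₃) z := h2
    rw [e1] at h3
    have h4 : deriv (fun y => 4 * L.weierstrassP y ^ 3 - L.g₂ * L.weierstrassP y - L.g₃) z = _ := e2
    rw [h4] at h3
    simp only [H]
    push_cast at h3
    norm_num at h3
    linear_combination h3 / 2
  have hmul : ∀ᶠ z in 𝓝 x, L.derivWeierstrassP z * H z = 0 := by
    filter_upwards [hopen.mem_nhds hx] with y hy using key y hy
  have hH : ∀ᶠ z in 𝓝[≠] x, H z = 0 := by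
    rcases haD.eventually_eq_zero_or_eventually_ne_zero with h | h
    · exact absurd h (deriv_P_not_eventually_zero L x hx)
    · filter_upwards [h, hmul.filter_mono nhdsWithin_le_nhds] with z h1 h2
      exact (mul_eq_zero.mp h2).resolve_left h1
  have hH0 : H x = 0 := by
    rcases haH.eventually_eq_zero_or_eventually_ne_zero with h | h
    · exact h.self_of_nhds
    · exact absurd (hH.and h) (by
        intro hh
        obtain ⟨z, hz1, hz2⟩ := hh.exists
        exact hz2 hz1)
  exact sub_eq_zero.mp hH0

lemma S4_eq (L : PeriodPair) (x : ℂ) (hx : x ∉ L.lattice) :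
    6 * L.sumInvPow x 4 = 6 * L.weierstrassP x ^ 2 - L.g₂ / 2 := by
  rw [← deriv_derivP L x hx, ← L.deriv_derivWeierstrassPExcept_self x,
    L.derivWeierstrassPExcept_of_notMem x hx]

lemma S6_eq (L : PeriodPair) (x : ℂ) (hx : x ∉ L.lattice) :
    120 * L.sumInvPow x 6 = 120 * L.weierstrassP x ^ 3 - 18 * L.g₂ * L.weierstrassP x
      - 12 * L.g₃ := by
  have hopen : IsOpen ((L.lattice : Set ℂ)ᶜ) := L.isClosed_lattice.isOpen_compl
  have h0 := L.iteratedDeriv_derivWeierstrassPExcept_self x (n := 3)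
  rw [L.derivWeierstrassPExcept_of_notMem x hx] at h0
  have hPd : ∀ z ∉ L.lattice, HasDerivAt L.weierstrassP (L.derivWeierstrassP z) z := by
    intro z hz
    rw [← L.deriv_weierstrassP]
    exact (L.analyticOnNhd_weierstrassP z hz).differentiableAt.hasDerivAt
  have hDd : ∀ z ∉ L.lattice, HasDerivAt L.derivWeierstrassP
      (6 * L.weierstrassP z ^ 2 - L.g₂ / 2) z := by
    intro z hz
    rw [← deriv_derivP L z hz]
    exact (L.analyticOnNhd_derivWeierstrassP z hz).differentiableAt.hasDerivAt
  have d1 : ∀ z ∉ L.lattice, deriv (deriv L.derivWeierstrassP) z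
      = 12 * (L.weierstrassP z * L.derivWeierstrassP z) := by
    intro z hz
    have : deriv L.derivWeierstrassP =ᶠ[𝓝 z] fun y => 6 * L.weierstrassP y ^ 2 - L.g₂ / 2 := by
      filter_upwards [hopen.mem_nhds hz] with y hy using deriv_derivP L y hy
    rw [this.deriv_eq]
    have := ((((hPd z hz).pow 2).const_mul 6).sub_const (L.g₂ / 2)).deriv
    refine Eq.trans this ?_
    norm_num
    ring
  have d2 : deriv (deriv (deriv L.derivWeierstrassP)) x
      = 12 * (L.derivWeierstrassP x ^ 2 +
        L.weierstrassP x * (6 * L.weierstrassP x ^ 2 - L.g₂ / 2)) := by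
    have : deriv (deriv L.derivWeierstrassP) =ᶠ[𝓝 x]
        fun y => 12 * (L.weierstrassP y * L.derivWeierstrassP y) := by
      filter_upwards [hopen.mem_nhds hx] with y hy using d1 y hy
    rw [this.deriv_eq]
    have := (((hPd x hx).mul (hDd x hx)).const_mul 12).deriv
    refine Eq.trans this ?_
    ring
  have h1 : iteratedDeriv 3 L.derivWeierstrassP x = deriv (deriv (deriv L.derivWeierstrassP)) x := by
    simp [iteratedDeriv_succ, iteratedDeriv_zero]
  rw [h1, d2, L.derivWeierstrassP_sq x hx] at h0
  norm_num [Nat.factorial] at h0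
  linear_combination -h0

/-- The period pair `(z, 1)`. -/
noncomputable def LL (z : ℍ) : PeriodPair where
  ω₁ := z
  ω₂ := 1
  indep := by
    rw [LinearIndependent.pair_iff]
    intro s t h
    have him := congrArg Complex.im h
    have hre := congrArg Complex.re h
    simp at him hre
    have hz : (z : ℂ).im ≠ 0 := z.im_ne_zero
    have hs : s = 0 := him.resolve_right z.im_ne_zero
    subst hs
    simpa using hre

lemma LL_tsum (z : ℍ) (f : ℂ → ℂ) :
    ∑' l : (LL z).lattice, f l = ∑' p : ℤ × ℤ, f (p.1 * z + p.2) := by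
  rw [← (LL z).latticeEquivProd.symm.toEquiv.tsum_eq]
  refine tsum_congr fun p => ?_
  have := (LL z).latticeEquiv_symm_apply p
  simp only [LL, mul_one] at this
  simp only [LinearEquiv.coe_toEquiv]
  exact congrArg f this

lemma LL_hasSum (z : ℍ) (f : ℂ → ℂ) (a : ℂ) :
    HasSum (fun l : (LL z).lattice => f l) a ↔ HasSum (fun p : ℤ × ℤ => f (p.1 * z + p.2)) a := by
  rw [← (LL z).latticeEquivProd.symm.toEquiv.hasSum_iff]
  have : ((fun l : (LL z).lattice => f l) ∘ (LL z).latticeEquivProd.symm.toEquiv) =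
      (fun p : ℤ × ℤ => f (p.1 * z + p.2)) := by
    funext p
    have := (LL z).latticeEquiv_symm_apply p
    simp only [LL, mul_one] at this
    simp only [LinearEquiv.coe_toEquiv, Function.comp]
    exact congrArg f this
  rw [this]

lemma LL_mem (z : ℍ) (x : ℂ) : x ∈ (LL z).lattice ↔ ∃ m n : ℤ, (m : ℂ) * z + n = x := by
  rw [PeriodPair.mem_lattice]
  simp [LL]

lemma LL_G (z : ℍ) (k : ℕ) :
    (LL z).G k = ∑' v, EisensteinSeries.eisSummand k v z := by
  rw [PeriodPair.G, LL_tsum z (fun l => (l ^ k)⁻¹), ← (finTwoArrowEquiv ℤ).symm.tsum_eq]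
  refine tsum_congr fun p => ?_
  simp [EisensteinSeries.eisSummand]

lemma sigma'_eq (k n : ℕ) : sigma' k n = ArithmeticFunction.sigma k n := by
  simp [sigma', ArithmeticFunction.sigma_apply]

lemma zeta_six : riemannZeta 6 = (Real.pi : ℂ) ^ 6 / 945 := by
  have := riemannZeta_two_mul_nat (k := 3) (by norm_num)
  norm_num [show bernoulli 6 = 1 / 42 by decide +kernel, Nat.factorial] at this
  rw [this]
  ring

lemma LL_G4 (z : ℍ) : (LL z).G 4 = (Real.pi : ℂ) ^ 4 / 45 * E4 z := by
  rw [LL_G, tsum_eisSummand_eq_tsum_sigma_mul_cexp_pow (by norm_num)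
    (by decide)]
  have h4 : riemannZeta ((4 : ℕ) : ℂ) = (Real.pi : ℂ) ^ 4 / 90 := by
    simpa using riemannZeta_four
  rw [h4, E4]
  simp only [sigma'_eq, qExp]
  have : (-2 * (Real.pi : ℂ) * Complex.I) ^ 4 = 16 * (Real.pi : ℂ) ^ 4 := by
    rw [mul_pow, mul_pow, Complex.I_pow_four]; norm_num
  rw [this]
  norm_num [Nat.factorial]
  ring

lemma LL_G6 (z : ℍ) : (LL z).G 6 = 2 * (Real.pi : ℂ) ^ 6 / 945 * E6 z := by
  rw [LL_G, tsum_eisSummand_eq_tsum_sigma_mul_cexp_pow (by norm_num)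
    (by decide)]
  have h4 : riemannZeta ((6 : ℕ) : ℂ) = (Real.pi : ℂ) ^ 6 / 945 := by
    simpa using zeta_six
  rw [h4, E6]
  simp only [sigma'_eq, qExp]
  have : (-2 * (Real.pi : ℂ) * Complex.I) ^ 6 = -64 * (Real.pi : ℂ) ^ 6 := by
    rw [mul_pow, mul_pow, show (6 : ℕ) = 4 + 2 from rfl, pow_add Complex.I, Complex.I_pow_four]
    simp; norm_num
  rw [this]
  norm_num [Nat.factorial]
  ring

lemma E2_eq (z : ℍ) : E2 z = EisensteinSeries.E2 z := by
  rw [EisensteinSeries.E2_eq_tsum_cexp, E2]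
  simp only [sigma'_eq, qExp]

lemma G2_eq (z : ℍ) : EisensteinSeries.G2 z = (Real.pi : ℂ) ^ 2 / 3 * E2 z := by
  rw [E2_eq, EisensteinSeries.E2]
  simp [riemannZeta_two]
  field

lemma E4_eq (z : ℍ) : E4 z = ModularForm.E₄ z := by
  rw [EisensteinSeries.q_expansion_bernoulli (by norm_num) (by decide), E4]
  simp only [sigma'_eq, qExp]
  norm_num [show bernoulli 4 = -1 / 30 by decide +kernel]

lemma E6_eq (z : ℍ) : E6 z = ModularForm.E₆ z := by
  rw [EisensteinSeries.q_expansion_bernoulli (by norm_num) (by decide), E6]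
  simp only [sigma'_eq, qExp]
  norm_num [show bernoulli 6 = 1 / 42 by decide +kernel]

/-- `w = (1 + √-19)/2` as a point of the upper half-plane. -/
noncomputable def wH : ℍ := ⟨(1 + Complex.I * (Real.sqrt 19 : ℂ)) / 2, by
  simp⟩

lemma wH_coe : (wH : ℂ) = (1 + Complex.I * (Real.sqrt 19 : ℂ)) / 2 := rfl

lemma sqrt19_sq : (Real.sqrt 19 : ℂ) ^ 2 = 19 := by
  rw [← Complex.ofReal_pow, Real.sq_sqrt (by norm_num)]; norm_num

lemma wH_sq : (wH : ℂ) ^ 2 = wH - 5 := by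
  rw [wH_coe]
  linear_combination (-1 / 4 : ℂ) * sqrt19_sq + (1 / 4 * (Real.sqrt 19 : ℂ) ^ 2) * Complex.I_sq

lemma wH_ne : (wH : ℂ) ≠ 0 := wH.ne_zero

lemma wH_inv : (1 : ℂ) / wH = (1 - wH) / 5 := by
  have := wH_ne
  field_simp
  linear_combination wH_sq

/-- Division with remainder by `w` on coordinates. -/
def divW : ((ℤ × ℤ) × Fin 5) ≃ ℤ × ℤ where
  toFun p := (p.1.1 + p.1.2, -(p.1.1 * 5 + (p.2 : ℕ)))
  invFun q := (((Int.divModEquiv 5 (-q.2)).1, q.1 - (Int.divModEquiv 5 (-q.2)).1),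
    (Int.divModEquiv 5 (-q.2)).2)
  left_inv := by
    rintro ⟨⟨m, n⟩, j⟩
    have := (Int.divModEquiv 5).apply_symm_apply (m, j)
    have h2 : (Int.divModEquiv 5).symm (m, j) = m * 5 + (j : ℕ) := rfl
    rw [h2] at this
    simp [this]
  right_inv := by
    rintro ⟨a, b⟩
    have : (Int.divModEquiv 5 (-b)).1 * 5 + ((Int.divModEquiv 5 (-b)).2 : ℕ) = -b :=
      (Int.divModEquiv 5).symm_apply_apply (-b)
    ext
    · simp
    · simp only
      rw [this, neg_neg]

lemma sum_sumInvPow (k : ℕ) (hk : 2 < k) :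
    ∑ j : Fin 5, (LL wH).sumInvPow (((j : ℕ) : ℂ) / wH) k = (wH : ℂ) ^ k * (LL wH).G k := by
  have hS : Summable fun p : ℤ × ℤ => (((p.1 : ℂ) * wH + p.2) ^ k)⁻¹ := by
    have := (LL wH).hasSum_sumInvPow 0 hk
    simp only [sub_zero] at this
    exact ((LL_hasSum wH (fun l => (l ^ k)⁻¹) _).mp this).summable
  have h1 : (LL wH).G k = ∑' p : ℤ × ℤ, (((p.1 : ℂ) * wH + p.2) ^ k)⁻¹ := by
    rw [PeriodPair.G, LL_tsum wH (fun l => (l ^ k)⁻¹)]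
  have h2 : ∀ j : Fin 5, (LL wH).sumInvPow (((j : ℕ) : ℂ) / wH) k =
      ∑' p : ℤ × ℤ, (((p.1 : ℂ) * wH + p.2 - ((j : ℕ) : ℂ) / wH) ^ k)⁻¹ := by
    intro j
    rw [PeriodPair.sumInvPow, LL_tsum wH (fun l => ((l - ((j : ℕ) : ℂ) / wH) ^ k)⁻¹)]
  have h3 : ∀ x : (ℤ × ℤ) × Fin 5, ((((divW x).1 : ℂ) * wH + (divW x).2) ^ k)⁻¹ =
      ((wH : ℂ) ^ k)⁻¹ * (((x.1.1 : ℂ) * wH + x.1.2 - ((x.2 : ℕ) : ℂ) / wH) ^ k)⁻¹ := by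
    rintro ⟨⟨m, n⟩, j⟩
    rw [← mul_inv, ← mul_pow]
    congr 2
    simp only [divW, Equiv.coe_fn_mk]
    push_cast
    have := wH_ne
    field_simp
    linear_combination (-(m : ℂ)) * wH_sq
  have hS' := divW.summable_iff.mpr hS
  have hswap := (Equiv.prodComm (Fin 5) (ℤ × ℤ)).summable_iff.mpr hS'
  rw [h1, ← divW.tsum_eq, ← (Equiv.prodComm (Fin 5) (ℤ × ℤ)).tsum_eq]
  have h4 : ∀ x : Fin 5 × (ℤ × ℤ), (((((divW ((Equiv.prodComm (Fin 5) (ℤ × ℤ)) x)).1 : ℤ) : ℂ) * wH + ((divW ((Equiv.prodComm (Fin 5) (ℤ × ℤ)) x)).2 : ℤ)) ^ k)⁻¹ = ((wH : ℂ) ^ k)⁻¹ * (((x.2.1 : ℂ) * wH + x.2.2 - ((x.1 : ℕ) : ℂ) / wH) ^ k)⁻¹ := by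
    rintro ⟨j, p⟩
    exact h3 (p, j)
  have hS2 : Summable fun x : Fin 5 × (ℤ × ℤ) => ((wH : ℂ) ^ k)⁻¹ * (((x.2.1 : ℂ) * wH + x.2.2 - ((x.1 : ℕ) : ℂ) / wH) ^ k)⁻¹ :=
    hswap.congr (fun x => (h4 x))
  rw [tsum_congr h4, hS2.tsum_prod, tsum_fintype, Finset.mul_sum]
  refine Finset.sum_congr rfl fun j _ => ?_
  rw [h2, tsum_mul_left, mul_inv_cancel_left₀ (pow_ne_zero _ wH_ne)]

lemma notMem_aux (j : ℕ) (h1 : 0 < j) (h2 : j < 5) : ((j : ℕ) : ℂ) / wH ∉ (LL wH).lattice := by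
  rw [LL_mem]
  rintro ⟨m, n, h⟩
  have h5 : ((5 * m + j : ℤ) : ℂ) * wH + ((5 * n - j : ℤ) : ℂ) = 0 := by
    have : ((j : ℕ) : ℂ) / wH = j * ((1 - wH) / 5) := by rw [← wH_inv]; ring
    rw [this] at h
    push_cast
    linear_combination 5 * h
  have him := congrArg Complex.im h5
  simp only [Complex.add_im, Complex.mul_im, Complex.intCast_re, Complex.intCast_im, zero_mul,
    add_zero, Complex.zero_im] at him
  have : ((5 * m + j : ℤ) : ℝ) = 0 := (mul_eq_zero.mp him).resolve_right wH.im_ne_zero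
  have : (5 * m + j : ℤ) = 0 := by exact_mod_cast this
  omega

lemma five_mem : (5 : ℂ) / wH ∈ (LL wH).lattice := by
  rw [LL_mem]
  refine ⟨-1, 1, ?_⟩
  have : (5 : ℂ) / wH = 5 * ((1 - wH) / 5) := by rw [← wH_inv]; ring
  rw [this]; push_cast; ring

lemma P_symm (j : ℂ) : (LL wH).weierstrassP ((5 - j) / wH) = (LL wH).weierstrassP (j / wH) := by
  have := (LL wH).weierstrassP_add_coe (-(j / wH)) ⟨_, five_mem⟩
  rw [(LL wH).weierstrassP_neg] at this
  rw [← this]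
  congr 1
  ring

lemma eq_four :
    2 * ((LL wH).weierstrassP (1 / wH) ^ 2 + (LL wH).weierstrassP (2 / wH) ^ 2)
      - (LL wH).g₂ / 3 = ((wH : ℂ) ^ 4 - 1) * (LL wH).g₂ / 60 := by
  have h := sum_sumInvPow 4 (by norm_num)
  have a1 := S4_eq (LL wH) _ (notMem_aux 1 (by norm_num) (by norm_num))
  have a2 := S4_eq (LL wH) _ (notMem_aux 2 (by norm_num) (by norm_num))
  have a3 := S4_eq (LL wH) _ (notMem_aux 3 (by norm_num) (by norm_num))
  have a4 := S4_eq (LL wH) _ (notMem_aux 4 (by norm_num) (by norm_num))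
  have p3 := P_symm 2
  have p4 := P_symm 1
  norm_num at p3 p4
  rw [Fin.sum_univ_five] at h
  norm_num at h a1 a2 a3 a4 ⊢
  rw [p3] at a3
  rw [p4] at a4
  have hg : (LL wH).g₂ = 60 * (LL wH).G 4 := rfl
  linear_combination h - (a1 + a2 + a3 + a4) / 6 - ((wH : ℂ) ^ 4 - 1) / 60 * hg

lemma eq_six :
    2 * ((LL wH).weierstrassP (1 / wH) ^ 3 + (LL wH).weierstrassP (2 / wH) ^ 3)
      - 3 / 10 * (LL wH).g₂ * ((LL wH).weierstrassP (1 / wH) + (LL wH).weierstrassP (2 / wH))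
      - 2 / 5 * (LL wH).g₃ = ((wH : ℂ) ^ 6 - 1) * (LL wH).g₃ / 140 := by
  have h := sum_sumInvPow 6 (by norm_num)
  have a1 := S6_eq (LL wH) _ (notMem_aux 1 (by norm_num) (by norm_num))
  have a2 := S6_eq (LL wH) _ (notMem_aux 2 (by norm_num) (by norm_num))
  have a3 := S6_eq (LL wH) _ (notMem_aux 3 (by norm_num) (by norm_num))
  have a4 := S6_eq (LL wH) _ (notMem_aux 4 (by norm_num) (by norm_num))
  have p3 := P_symm 2
  have p4 := P_symm 1
  norm_num at p3 p4
  rw [Fin.sum_univ_five] at h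
  norm_num at h a1 a2 a3 a4 ⊢
  rw [p3] at a3
  rw [p4] at a4
  have hg : (LL wH).g₃ = 140 * (LL wH).G 6 := rfl
  linear_combination h - (a1 + a2 + a3 + a4) / 120 - ((wH : ℂ) ^ 6 - 1) / 140 * hg

/-- `t = -1/w`. -/
noncomputable def tH : ℍ := ModularGroup.S • wH

lemma tH_coe : (tH : ℂ) = -(1 / wH) := by
  rw [tH, UpperHalfPlane.modular_S_smul]
  simp

lemma wH_eq_tH : (wH : ℂ) = 1 + 5 * tH := by
  rw [tH_coe, wH_inv]; ring

lemma e2Summand_hasSum (m : ℤ) (z : ℍ) :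
    HasSum (fun n : ℤ => (((m : ℂ) * z + n) ^ 2)⁻¹) (EisensteinSeries.e2Summand m z) := by
  have := (EisensteinSeries.e2Summand_summable m z).hasSum
  have h2 : (fun n : ℤ => EisensteinSeries.eisSummand 2 ![m, n] z) =
      fun n : ℤ => (((m : ℂ) * z + n) ^ 2)⁻¹ := by
    funext n
    simp [EisensteinSeries.eisSummand]
  rw [h2] at this
  rw [EisensteinSeries.e2Summand, h2]
  exact this

lemma row_hasSum (m j : ℤ) :
    HasSum (fun n : ℤ => (((m : ℂ) * wH + n + j * tH) ^ 2)⁻¹)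
      (EisensteinSeries.e2Summand (m * 5 + j) tH) := by
  have := (Equiv.addRight m).hasSum_iff.mpr (e2Summand_hasSum (m * 5 + j) tH)
  convert this using 2 with n
  simp only [Function.comp, Equiv.coe_addRight]
  rw [wH_eq_tH]
  push_cast
  ring

lemma P_hasSum (j : ℕ) :
    HasSum (fun m : ℤ => EisensteinSeries.e2Summand (m * 5 + j) tH
      - EisensteinSeries.e2Summand m wH) ((LL wH).weierstrassP ((j : ℂ) / wH)) := by
  have h := (LL wH).hasSum_weierstrassP ((j : ℂ) / wH)
  rw [LL_hasSum wH (fun l => 1 / ((j : ℂ) / wH - l) ^ 2 - 1 / l ^ 2)] at h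
  refine h.prod_fiberwise fun m => ?_
  have h1 := (row_hasSum m j).sub (e2Summand_hasSum m wH)
  have e : (fun n : ℤ => 1 / ((j : ℂ) / wH - ((m : ℂ) * wH + n)) ^ 2
      - 1 / ((m : ℂ) * wH + n) ^ 2) = fun n : ℤ =>
      (((m : ℂ) * wH + n + ((j : ℤ) : ℂ) * tH) ^ 2)⁻¹ - (((m : ℂ) * wH + n) ^ 2)⁻¹ := by
    funext n
    have : (j : ℂ) / wH = -(j * tH) := by rw [tH_coe]; ring
    rw [this]
    simp only [one_div]
    congr 2
    push_cast
    ring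
  rw [← e] at h1
  exact h1

lemma Ico_five (f : ℤ → ℂ) (M : ℕ) :
    ∑ m ∈ Finset.Ico (-M : ℤ) M, ∑ j : Fin 5, f (m * 5 + ((j : ℕ) : ℤ)) =
      ∑ n ∈ Finset.Ico (-((5 * M : ℕ) : ℤ)) ((5 * M : ℕ) : ℤ), f n := by
  rw [← Finset.sum_product']
  refine Finset.sum_equiv (Int.divModEquiv 5).symm ?_ ?_
  · rintro ⟨m, j⟩
    have h2 : (Int.divModEquiv 5).symm (m, j) = m * 5 + (j : ℕ) := rfl
    rw [h2]
    have := j.2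
    simp only [Finset.mem_product, Finset.mem_Ico, Finset.mem_univ, and_true]
    push_cast
    omega
  · rintro ⟨m, j⟩ _
    rfl

lemma P_sum : ∑ j : Fin 5, (LL wH).weierstrassP (((j : ℕ) : ℂ) / wH) =
    EisensteinSeries.G2 tH - 5 * EisensteinSeries.G2 wH := by
  have h := hasSum_sum (s := Finset.univ) (fun (j : Fin 5) _ => P_hasSum (j : ℕ))
  have hten : Tendsto (fun M : ℕ => Finset.Ico (-M : ℤ) M) atTop atTop := by
    refine tendsto_atTop_finset_of_monotone ?_ ?_
    · intro a b hab
      refine Finset.Ico_subset_Ico ?_ ?_ <;> simpa using hab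
    · intro x
      refine ⟨x.natAbs + 1, ?_⟩
      simp only [Finset.mem_Ico]
      push_cast
      have := neg_abs_le x
      have := le_abs_self x
      constructor <;> linarith
  have h2 : Tendsto (fun M : ℕ => ∑ m ∈ Finset.Ico (-M : ℤ) M, ∑ j : Fin 5,
      (EisensteinSeries.e2Summand (m * 5 + ((j : ℕ) : ℤ)) tH
      - EisensteinSeries.e2Summand m wH)) atTop
      (𝓝 (∑ j : Fin 5, (LL wH).weierstrassP (((j : ℕ) : ℂ) / wH))) := by
    rw [HasSum] at h
    simp only [SummationFilter.unconditional_filter] at h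
    exact h.comp hten
  have hG : ∀ z : ℍ, Tendsto (fun M : ℕ => ∑ m ∈ Finset.Ico (-M : ℤ) M,
      EisensteinSeries.e2Summand m z) atTop (𝓝 (EisensteinSeries.G2 z)) := by
    intro z
    have := EisensteinSeries.hasSum_e2Summand_symmetricIco z
    rw [← EisensteinSeries.G2_eq_tsum_cexp] at this
    exact SummationFilter.hasSum_symmetricIco_int_iff.mp this
  have h5 : Tendsto (fun M : ℕ => 5 * M) atTop atTop :=
    tendsto_id.const_mul_atTop' (by norm_num)
  have h3 := ((hG tH).comp h5).sub ((hG wH).const_mul 5)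
  refine tendsto_nhds_unique h2 (h3.congr fun M => ?_)
  simp only [Function.comp]
  rw [← Ico_five (fun n => EisensteinSeries.e2Summand n tH), Finset.mul_sum,
    ← Finset.sum_sub_distrib]
  refine Finset.sum_congr rfl fun m _ => ?_
  rw [Finset.sum_sub_distrib]
  simp

lemma G2_tH : EisensteinSeries.G2 tH =
    (wH : ℂ) ^ 2 * EisensteinSeries.G2 wH - 2 * Real.pi * Complex.I * wH := by
  have h := congrFun (EisensteinSeries.G2_slash_action ModularGroup.S) wH
  rw [ModularForm.SL_slash_apply, Pi.sub_apply, EisensteinSeries.D2_S] at h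
  have hd : UpperHalfPlane.denom (Matrix.SpecialLinearGroup.toGL
      ((Matrix.SpecialLinearGroup.map (Int.castRingHom ℝ)) ModularGroup.S)) (wH : ℂ) = wH := by
    simpa [ModularGroup.S] using ModularGroup.denom_apply ModularGroup.S wH
  rw [hd] at h
  change EisensteinSeries.G2 tH * _ = _ at h
  have := wH_ne
  have h2 : (wH : ℂ) ^ (-2 : ℤ) = ((wH : ℂ) ^ 2)⁻¹ := by
    rw [_root_.zpow_neg]; rfl
  rw [h2] at h
  field_simp at h
  linear_combination h

lemma eq_two : 2 * ((LL wH).weierstrassP (1 / wH) + (LL wH).weierstrassP (2 / wH)) =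
    ((wH : ℂ) - 10) * EisensteinSeries.G2 wH - 2 * Real.pi * Complex.I * wH := by
  have h := P_sum
  rw [G2_tH] at h
  have p3 := P_symm 2
  have p4 := P_symm 1
  norm_num at p3 p4
  rw [Fin.sum_univ_five] at h
  norm_num at h ⊢
  rw [p3, p4] at h
  linear_combination h + EisensteinSeries.G2 wH * wH_sq

/-- The matrix taking `w` to the Heegner point. -/
def AA : Matrix.SpecialLinearGroup (Fin 2) ℤ := ⟨!![1, 0; -2, 1], by decide⟩

lemma AA_denom : UpperHalfPlane.denom (Matrix.SpecialLinearGroup.toGL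
      ((Matrix.SpecialLinearGroup.map (Int.castRingHom ℝ)) AA)) (wH : ℂ)
      = -(Complex.I * (Real.sqrt 19 : ℂ)) := by
  have h : UpperHalfPlane.denom (Matrix.SpecialLinearGroup.toGL
      ((Matrix.SpecialLinearGroup.map (Int.castRingHom ℝ)) AA)) (wH : ℂ) = -2 * wH + 1 := by
    simpa [AA] using ModularGroup.denom_apply AA wH
  rw [h, wH_coe]; ring

lemma I19_sq : (Complex.I * (Real.sqrt 19 : ℂ)) ^ 2 = -19 := by
  rw [mul_pow, Complex.I_sq, sqrt19_sq]; norm_num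

lemma I19_ne : (Complex.I * (Real.sqrt 19 : ℂ)) ≠ 0 := by
  intro h
  have := I19_sq
  rw [h] at this
  norm_num at this

lemma AA_smul : ((AA • wH : ℍ) : ℂ) = (-19 + Complex.I * (Real.sqrt 19 : ℂ)) / 38 := by
  rw [UpperHalfPlane.specialLinearGroup_apply]
  have : (-2 * (wH : ℂ) + 1) = -(Complex.I * (Real.sqrt 19 : ℂ)) := by rw [wH_coe]; ring
  simp [AA]
  rw [← neg_mul, this, wH_coe]
  have := I19_ne
  rw [div_eq_div_iff (neg_ne_zero.mpr this) (by norm_num)]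
  linear_combination I19_sq

lemma E4_tau : E4 ((-19 + Complex.I * (Real.sqrt 19 : ℂ)) / 38) = 361 * E4 wH := by
  rw [← AA_smul, E4_eq, E4_eq]
  have h := congrFun (show SlashAction.map (4 : ℤ) AA (⇑ModularForm.E₄) = ⇑ModularForm.E₄ from
    ModularForm.E₄.slash_action_eq' _ ⟨AA, rfl⟩) wH
  rw [ModularForm.SL_slash_apply, AA_denom, _root_.zpow_neg,
    mul_inv_eq_iff_eq_mul₀ (zpow_ne_zero _ (neg_ne_zero.mpr I19_ne))] at h
  rw [h, mul_comm]
  congr 1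
  have : (-(Complex.I * (Real.sqrt 19 : ℂ))) ^ (4 : ℤ) =
    ((Complex.I * (Real.sqrt 19 : ℂ)) ^ 2) ^ 2 := by norm_cast; ring
  refine Eq.trans this ?_
  rw [I19_sq]; norm_num

lemma E6_tau : E6 ((-19 + Complex.I * (Real.sqrt 19 : ℂ)) / 38) = -6859 * E6 wH := by
  rw [← AA_smul, E6_eq, E6_eq]
  have h := congrFun (show SlashAction.map (6 : ℤ) AA (⇑ModularForm.E₆) = ⇑ModularForm.E₆ from
    ModularForm.E₆.slash_action_eq' _ ⟨AA, rfl⟩) wH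
  rw [ModularForm.SL_slash_apply, AA_denom, _root_.zpow_neg,
    mul_inv_eq_iff_eq_mul₀ (zpow_ne_zero _ (neg_ne_zero.mpr I19_ne))] at h
  rw [h, mul_comm]
  congr 1
  have : (-(Complex.I * (Real.sqrt 19 : ℂ))) ^ (6 : ℤ) =
    ((Complex.I * (Real.sqrt 19 : ℂ)) ^ 2) ^ 3 := by norm_cast; ring
  refine Eq.trans this ?_
  rw [I19_sq]; norm_num

lemma E2_tau : E2 ((-19 + Complex.I * (Real.sqrt 19 : ℂ)) / 38) =
    -19 * (E2 wH - 12 / (Real.pi * (Real.sqrt 19 : ℂ))) := by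
  rw [← AA_smul, E2_eq, E2_eq]
  have h := congrFun (EisensteinSeries.E2_slash_action AA) wH
  rw [ModularForm.SL_slash_apply, AA_denom] at h
  simp only [Pi.sub_apply, Pi.smul_apply, EisensteinSeries.D2, smul_eq_mul] at h
  rw [AA_denom] at h
  have h2 : (-(Complex.I * (Real.sqrt 19 : ℂ))) ^ (-2 : ℤ) = (-19)⁻¹ := by
    rw [_root_.zpow_neg, ← I19_sq]; norm_cast; ring
  rw [h2, riemannZeta_two] at h
  have hAA : ((AA 1 0 : ℤ) : ℂ) = -2 := by simp [AA]
  rw [hAA] at h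
  have hs : (Real.sqrt 19 : ℂ) ≠ 0 := (mul_ne_zero_iff.mp I19_ne).2
  have hpi : (Real.pi : ℂ) ≠ 0 := by exact_mod_cast Real.pi_ne_zero
  have h3 : (1 / (2 * ((Real.pi : ℂ) ^ 2 / 6)) * (2 * Real.pi * Complex.I * -2 / -(Complex.I * (Real.sqrt 19 : ℂ)))) = 12 / (Real.pi * (Real.sqrt 19 : ℂ)) := by
    have := Complex.I_ne_zero
    field_simp
    norm_num
  rw [h3] at h
  linear_combination -19 * h

lemma qExp_w : qExp wH = ((-Real.exp (-(Real.pi * Real.sqrt 19)) : ℝ) : ℂ) := by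
  rw [qExp, wH_coe]
  have : 2 * (Real.pi : ℂ) * Complex.I * ((1 + Complex.I * (Real.sqrt 19 : ℂ)) / 2) =
      Real.pi * Complex.I + ((-(Real.pi * Real.sqrt 19) : ℝ) : ℂ) := by
    push_cast
    linear_combination (Real.pi : ℂ) * (Real.sqrt 19 : ℂ) * Complex.I_sq
  rw [this, Complex.exp_add, Complex.exp_pi_mul_I, ← Complex.ofReal_exp]
  push_cast; ring

lemma qExp_tau_pow : qExp ((-19 + Complex.I * (Real.sqrt 19 : ℂ)) / 38) ^ 19 = qExp wH := by
  rw [qExp, qExp, ← Complex.exp_nat_mul, Complex.exp_eq_exp_iff_exists_int]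
  refine ⟨-10, ?_⟩
  rw [wH_coe]; push_cast; ring

lemma summable_sigma (z : ℍ) : Summable fun n : ℕ+ => (sigma' 1 n : ℂ) * qExp z ^ (n : ℕ) := by
  have := EisensteinSeries.summable_sigma_mul_cexp_pow (k := 2) (by norm_num) z
  have h := this.comp_injective PNat.coe_injective
  refine h.congr fun n => ?_
  simp [sigma'_eq, qExp]

lemma E2N_tau : E2N 19 ((-19 + Complex.I * (Real.sqrt 19 : ℂ)) / 38) =
    19 / 12 * (E2 wH - 6 / (Real.pi * (Real.sqrt 19 : ℂ))) := by
  have h1 := summable_sigma (AA • wH)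
  rw [AA_smul] at h1
  have h2 := summable_sigma wH
  have hE := E2_tau
  have key : ∀ n : ℕ+, (sigma' 1 n : ℂ) * (qExp ((-19 + Complex.I * (Real.sqrt 19 : ℂ)) / 38) ^ (n : ℕ) -
      ((19 : ℕ) : ℂ) * qExp ((-19 + Complex.I * (Real.sqrt 19 : ℂ)) / 38) ^ (19 * (n : ℕ))) =
      (sigma' 1 n : ℂ) * qExp ((-19 + Complex.I * (Real.sqrt 19 : ℂ)) / 38) ^ (n : ℕ) -
      19 * ((sigma' 1 n : ℂ) * qExp wH ^ (n : ℕ)) := by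
    intro n
    rw [pow_mul, qExp_tau_pow]
    push_cast; ring
  rw [E2N, tsum_congr key, h1.tsum_sub (h2.mul_left 19), tsum_mul_left]
  rw [E2] at hE
  have hw : E2 wH = 1 - 24 * ∑' n : ℕ+, (sigma' 1 n : ℂ) * qExp wH ^ (n : ℕ) := rfl
  push_cast
  linear_combination (-1 / 24 : ℂ) * hE - (19 / 24 : ℂ) * hw

lemma E_real (k : ℕ) : ∃ r : ℝ, (∑' n : ℕ+, (sigma' k n : ℂ) * qExp wH ^ (n : ℕ)) = (r : ℂ) := by
  refine ⟨∑' n : ℕ+, (sigma' k n : ℝ) * (-Real.exp (-(Real.pi * Real.sqrt 19))) ^ (n : ℕ), ?_⟩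
  rw [Complex.ofReal_tsum]
  refine tsum_congr fun n => ?_
  rw [qExp_w]
  push_cast
  rfl

lemma sigma_le (n : ℕ) : (sigma' 1 n : ℝ) ≤ 4 ^ n := by
  have h1 : sigma' 1 n ≤ n * n := by
    unfold sigma'
    calc ∑ d ∈ n.divisors, d ^ 1 ≤ n.divisors.card • n := by
          refine Finset.sum_le_card_nsmul _ _ _ fun d hd => ?_
          simpa using Nat.divisor_le hd
      _ ≤ n * n := by
          rw [smul_eq_mul]
          exact Nat.mul_le_mul_right _ (Nat.card_divisors_le_self n)
  have h2 : n * n ≤ 4 ^ n := by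
    have h := (Nat.lt_two_pow_self (n := n)).le
    calc n * n ≤ 2 ^ n * 2 ^ n := Nat.mul_le_mul h h
      _ = 4 ^ n := by rw [← mul_pow]; norm_num
  exact_mod_cast h1.trans h2

lemma pi_sqrt_ge : 12 ≤ Real.pi * Real.sqrt 19 := by
  have h1 : (4 : ℝ) ≤ Real.sqrt 19 := by
    rw [Real.le_sqrt (by norm_num) (by norm_num)]; norm_num
  nlinarith [Real.pi_gt_three]

lemma rho_le : 4 * Real.exp (-(Real.pi * Real.sqrt 19)) ≤ 1 / 1000 := by
  have h1 : Real.exp (-(Real.pi * Real.sqrt 19)) ≤ Real.exp (-12) :=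
    Real.exp_le_exp.mpr (by linarith [pi_sqrt_ge])
  have h2 : Real.exp (-12) ≤ 1 / 4000 := by
    rw [Real.exp_neg, ← one_div]
    apply one_div_le_one_div_of_le (by norm_num)
    have h3 : Real.exp 12 = Real.exp 1 ^ 12 := by
      rw [← Real.exp_nat_mul]; norm_num
    rw [h3]
    have h4 : (2.7 : ℝ) ≤ Real.exp 1 := by linarith [Real.exp_one_gt_d9]
    calc (4000 : ℝ) ≤ 2.7 ^ 12 := by norm_num
      _ ≤ _ := by gcongr
  linarith

lemma sum_small : ‖∑' n : ℕ+, (sigma' 1 n : ℂ) * qExp wH ^ (n : ℕ)‖ ≤ 1 / 999 := by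
  have hs : HasSum (fun n : ℕ+ => (1 / 1000 : ℝ) ^ (n : ℕ)) (1 / 999) := by
    rw [← Equiv.pnatEquivNat.symm.hasSum_iff]
    have h := (hasSum_geometric_of_lt_one (r := (1 / 1000 : ℝ)) (by norm_num)
      (by norm_num)).mul_left (1 / 1000 : ℝ)
    have e1 : (1 / 1000 : ℝ) * (1 - 1 / 1000)⁻¹ = 1 / 999 := by norm_num
    have e2 : ((fun n : ℕ+ => (1 / 1000 : ℝ) ^ (n : ℕ)) ∘ Equiv.pnatEquivNat.symm) =
        fun i : ℕ => (1 / 1000 : ℝ) * (1 / 1000) ^ i := by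
      funext n
      simp [pow_succ', mul_comm]
    rw [e1] at h
    rw [e2]
    exact h
  refine tsum_of_norm_bounded hs fun n => ?_
  rw [norm_mul, norm_pow, qExp_w, Complex.norm_real, Complex.norm_natCast, norm_neg,
    Real.norm_of_nonneg (Real.exp_pos _).le]
  calc (sigma' 1 n : ℝ) * Real.exp (-(Real.pi * Real.sqrt 19)) ^ (n : ℕ)
      ≤ 4 ^ (n : ℕ) * Real.exp (-(Real.pi * Real.sqrt 19)) ^ (n : ℕ) := by
        gcongr
        exact sigma_le n
    _ = (4 * Real.exp (-(Real.pi * Real.sqrt 19))) ^ (n : ℕ) := by rw [mul_pow]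
    _ ≤ _ := by
        gcongr
        exact rho_le

lemma reals : ∃ e r4 r6 : ℝ, e ≠ 0 ∧ E2 wH - 6 / (Real.pi * (Real.sqrt 19 : ℂ)) = (e : ℂ) ∧
    E4 wH = (r4 : ℂ) ∧ E6 wH = (r6 : ℂ) := by
  obtain ⟨s1, h1⟩ := E_real 1
  obtain ⟨s3, h3⟩ := E_real 3
  obtain ⟨s5, h5⟩ := E_real 5
  refine ⟨1 - 24 * s1 - 6 / (Real.pi * Real.sqrt 19), 1 + 240 * s3, 1 - 504 * s5, ?_, ?_, ?_, ?_⟩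
  · have h := sum_small
    rw [h1, Complex.norm_real, Real.norm_eq_abs] at h
    have h' := (abs_le.mp h).2
    have h6 : 6 / (Real.pi * Real.sqrt 19) ≤ 6 / 12 :=
      div_le_div_of_nonneg_left (by norm_num) (by norm_num) pi_sqrt_ge
    apply ne_of_gt
    norm_num at h6 h'
    linarith
  · rw [E2, h1]; push_cast; ring
  · rw [E4, h3]; push_cast; ring
  · rw [E6, h5]; push_cast; ring

lemma indep (A C : ℝ) (h : (A : ℂ) * (Complex.I * (Real.sqrt 19 : ℂ)) + (C : ℂ) = 0) :
    A = 0 ∧ C = 0 := by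
  have h1 := congrArg Complex.im h
  have h2 := congrArg Complex.re h
  simp at h1 h2
  exact ⟨h1, h2⟩

lemma main_rel (e r4 r6 : ℝ) (he : e ≠ 0)
    (h2 : E2 wH - 6 / (Real.pi * (Real.sqrt 19 : ℂ)) = (e : ℂ))
    (h4 : E4 wH = (r4 : ℂ)) (h6 : E6 wH = (r6 : ℂ)) :
    r4 = 19 / 6 * e ^ 2 ∧ r6 = 361 / 64 * e ^ 3 := by
  have q4 := eq_four
  have q6 := eq_six
  have q2 := eq_two
  have hg2 : (LL wH).g₂ = 60 * (Real.pi ^ 4 / 45 * r4) := by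
    rw [← h4, ← LL_G4]; rfl
  have hg3 : (LL wH).g₃ = 140 * (2 * Real.pi ^ 6 / 945 * r6) := by
    rw [← h6, ← LL_G6]; rfl
  rw [G2_eq] at q2
  rw [hg2] at q4
  rw [hg2, hg3] at q6
  generalize (LL wH).weierstrassP (1 / (wH : ℂ)) = P1 at q2 q4 q6
  generalize (LL wH).weierstrassP (2 / (wH : ℂ)) = P2 at q2 q4 q6
  have hw2 := wH_sq
  have hw := wH_ne
  have hJ : (2 * (wH : ℂ) - 1) = Complex.I * (Real.sqrt 19 : ℂ) := by rw [wH_coe]; ring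
  have hs : (Real.sqrt 19 : ℂ) ≠ 0 := (mul_ne_zero_iff.mp I19_ne).2
  have hpi : (Real.pi : ℂ) ≠ 0 := by exact_mod_cast Real.pi_ne_zero
  have hE2 : E2 wH = e + 6 / (Real.pi * (Real.sqrt 19 : ℂ)) := by rw [← h2]; ring
  rw [hE2] at q2
  generalize (wH : ℂ) = w at *
  have hw10 : w - 10 = w * (Complex.I * (Real.sqrt 19 : ℂ)) := by
    rw [← hJ]; linear_combination -2 * hw2
  have hs2 : P1 + P2 = w * (2 * w - 1) * (Real.pi ^ 2 / 6 * e) := by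
    have h : w * (Complex.I * (Real.sqrt 19 : ℂ)) *
        (Real.pi ^ 2 / 3 * (6 / (Real.pi * (Real.sqrt 19 : ℂ)))) = 2 * Real.pi * Complex.I * w := by
      field_simp
      norm_num
    rw [hw10] at q2
    rw [hJ]
    linear_combination q2 / 2 + h / 2
  have hw4 : w ^ 4 = 20 - 9 * w := by linear_combination (w ^ 2 + w - 4) * hw2
  have hw6 : w ^ 6 = 56 * w - 55 := by
    linear_combination (w ^ 2) * hw4 + (-9 * w + 11) * hw2
  rw [hw4] at q4
  rw [hw6] at q6
  have hP2 : P2 = w * (2 * w - 1) * (Real.pi ^ 2 / 6 * e) - P1 := by linear_combination hs2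
  generalize hS : w * (2 * w - 1) * (Real.pi ^ 2 / 6 * (e : ℂ)) = S at *
  subst hP2
  have key : -S ^ 3 + 60 * (Real.pi ^ 4 / 45 * r4) * S * (9 * (3 - w) / 40) =
      2 / 5 * w * (140 * (2 * Real.pi ^ 6 / 945 * r6)) := by
    linear_combination q6 - 3 * S / 2 * q4
  have hpi6 : (Real.pi : ℂ) ^ 6 * w ≠ 0 := mul_ne_zero (pow_ne_zero _ hpi) hw
  have key2 : (2 * w - 1) * (19 * (w - 5) * (e : ℂ) ^ 3 / 216 +
      (1 / 20) * (r4 : ℂ) * e * (3 - w)) = 16 / 135 * r6 := by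
    apply mul_left_cancel₀ hpi6
    have hw3 : (2 * w - 1) ^ 2 = -19 := by linear_combination 4 * hw2
    rw [← hS] at key
    have e1 : (w * (2 * w - 1) * (Real.pi ^ 2 / 6 * (e : ℂ))) ^ 3 =
      w * (w - 5) * (-19) * (2 * w - 1) * Real.pi ^ 6 * e ^ 3 / 216 := by
      rw [← hw3, ← hw2]; ring
    rw [e1] at key
    linear_combination key
  have hfin : ((e * (r4 / 8 - 19 * e ^ 2 / 48) : ℝ) : ℂ) * (Complex.I * (Real.sqrt 19 : ℂ)) +
      ((-19 * (19 * e ^ 3 / 432 - r4 * e / 40) - 16 / 135 * r6 : ℝ) : ℂ) = 0 := by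
    rw [← hJ]
    push_cast
    linear_combination key2 - 4 * (19 * (e : ℂ) ^ 3 / 432 - r4 * e / 40) * hw2
  obtain ⟨f1, f2⟩ := indep _ _ hfin
  have f3 : r4 = 19 / 6 * e ^ 2 := by
    have := (mul_eq_zero.mp f1).resolve_left he
    linarith
  refine ⟨f3, ?_⟩
  rw [f3] at f2
  linear_combination (-135 / 16) * f2

/-- At the Heegner point `τ = (−19 + i√19)/38` of discriminant `−19`, which represents the
unique non-cuspidal rational point of `X₀(19)`, the invariants `a₄` and `a₆` take the
stated rational values. -/
theorem a4_a6_at_heegner_19 :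
    E2N 19 ((-19 + Complex.I * (Real.sqrt 19 : ℂ)) / 38) ≠ 0 ∧
    a4 19 ((-19 + Complex.I * (Real.sqrt 19 : ℂ)) / 38) = -19 / 2 ∧
    a6 19 ((-19 + Complex.I * (Real.sqrt 19 : ℂ)) / 38) = -361 / 32 := by
  obtain ⟨e, r4, r6, he, h2, h4, h6⟩ := reals
  obtain ⟨f4, f6⟩ := main_rel e r4 r6 he h2 h4 h6
  have hec : (e : ℂ) ≠ 0 := by exact_mod_cast he
  rw [a4, a6, E4_tau, E6_tau, E2N_tau, h2, h4, h6, f4, f6]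
  push_cast
  refine ⟨mul_ne_zero (by norm_num) hec, ?_, ?_⟩
  · field_simp
    norm_num
  · field_simp
    norm_num
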